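/- Let G be a finite abelian group. Suppose there exists a natural number t such that |S| ≤ t for every sequence S over G with 0 not a term of S, |S| ≥ D(G) − 1, and N_0(S) = 2^{|S|−D(G)+1}. Then for every subgroup H of G isomorphic to C_2, one has D(G) ≥ D(G/H) + 2. -/

import Mathlib

/-- `NSub S g` is the number of subsequences (sub-multisets, counted with the
multiplicity of their appearance in `S`) of the sequence `S` with sum `g`. -/
def NSub {G : Type*} [AddCommGroup G] [DecidableEq G] (S : Multiset G) (g : G) : ℕ :=
  (S.powerset.filter (fun T => T.sum = g)).card

/-- The Davenport constant of `G`: the smallest positive integer `ℓ` such that every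
sequence over `G` of length at least `ℓ` has a nonempty zero-sum subsequence. -/
noncomputable def Davenport (G : Type*) [AddCommGroup G] : ℕ :=
  sInf {ℓ : ℕ | 0 < ℓ ∧ ∀ S : Multiset G, ℓ ≤ Multiset.card S →
    ∃ T : Multiset G, T ≤ S ∧ T ≠ 0 ∧ T.sum = 0}

/-- `ESet S = {g ∈ G : N_g(S) = 2 ^ (|S| - D(G) + 1)}`. -/
def ESet {G : Type*} [AddCommGroup G] [DecidableEq G] (S : Multiset G) : Set G :=
  {g | NSub S g = 2 ^ (Multiset.card S + 1 - Davenport G)}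

/-- A minimal zero-sum sequence: nonempty, zero-sum, and every nonempty proper
subsequence has nonzero sum. -/
def IsMinZeroSum {G : Type*} [AddCommGroup G] (T : Multiset G) : Prop :=
  T ≠ 0 ∧ T.sum = 0 ∧ ∀ U : Multiset G, U ≤ T → U ≠ 0 → U ≠ T → U.sum ≠ 0

theorem NSub_cons {G : Type*} [AddCommGroup G] [DecidableEq G] (a : G) (S : Multiset G) (g : G) :
    NSub (a ::ₘ S) g = NSub S g + NSub S (g - a) := by
  simp only [NSub, Multiset.powerset_cons, Multiset.filter_add, Multiset.card_add,
    Multiset.filter_map, Multiset.card_map, Function.comp_def, Multiset.sum_cons,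
    eq_sub_iff_add_eq']

theorem NSub_eq_zero {G : Type*} [AddCommGroup G] [DecidableEq G] {S : Multiset G} {g : G}
    (h : ∀ U ≤ S, U.sum ≠ g) : NSub S g = 0 := by
  rw [NSub, Multiset.card_eq_zero, Multiset.filter_eq_nil]
  exact fun U hU => h U (Multiset.mem_powerset.1 hU)

theorem NSub_zero_eq_one {G : Type*} [AddCommGroup G] [DecidableEq G] {S : Multiset G}
    (h : ∀ U ≤ S, U ≠ 0 → U.sum ≠ 0) : NSub S 0 = 1 := by
  induction S using Multiset.induction_on with
  | empty => simp [NSub, Multiset.filter_singleton]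
  | cons a S ih =>
    rw [NSub_cons, ih fun U hU => h U (hU.trans (Multiset.le_cons_self _ _)),
      NSub_eq_zero fun U hU hs => ?_]
    refine h (a ::ₘ U) (Multiset.cons_le_cons a hU) (Multiset.cons_ne_zero) ?_
    simp [hs]

/-- Appending copies of an element `h` of order two splits the subsequence sums evenly
between `0` and `h`. -/
theorem NSub_add_replicate {G : Type*} [AddCommGroup G] [DecidableEq G] {S : Multiset G} {h : G}
    (hh : h + h = 0) (h0 : NSub S 0 = 1) (h1 : NSub S h = 0) (n : ℕ) :
    NSub (S + Multiset.replicate (n + 1) h) 0 = 2 ^ n ∧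
      NSub (S + Multiset.replicate (n + 1) h) h = 2 ^ n := by
  have hneg : -h = h := neg_eq_of_add_eq_zero_left hh
  induction n with
  | zero =>
    rw [zero_add, Multiset.replicate_one, Multiset.add_comm, Multiset.singleton_add, NSub_cons,
      NSub_cons, zero_sub, hneg, sub_self, h0, h1]
    simp
  | succ n ih =>
    rw [Multiset.replicate_succ, Multiset.add_cons, NSub_cons, NSub_cons, zero_sub, hneg, sub_self,
      ih.1, ih.2, pow_succ]
    omega

theorem Davenport_spec (G : Type*) [AddCommGroup G] [Finite G] :
    0 < Davenport G ∧ ∀ S : Multiset G, Davenport G ≤ Multiset.card S →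
      ∃ T : Multiset G, T ≤ S ∧ T ≠ 0 ∧ T.sum = 0 := by
  classical
  have := Fintype.ofFinite G
  refine Nat.sInf_mem (s := {ℓ : ℕ | 0 < ℓ ∧ ∀ S : Multiset G, ℓ ≤ Multiset.card S →
    ∃ T : Multiset G, T ≤ S ∧ T ≠ 0 ∧ T.sum = 0})
    ⟨Fintype.card G * Fintype.card G, Nat.mul_pos Fintype.card_pos Fintype.card_pos, ?_⟩
  intro S hS
  obtain ⟨g, hg⟩ : ∃ g, Fintype.card G ≤ S.count g := by
    by_contra! hlt
    have hsum : ∑ g : G, S.count g < ∑ _g : G, Fintype.card G :=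
      Finset.sum_lt_sum_of_nonempty Finset.univ_nonempty fun g _ => hlt g
    rw [Multiset.sum_count_eq_card fun a _ => Finset.mem_univ a] at hsum
    simp only [Finset.sum_const, Finset.card_univ, smul_eq_mul] at hsum
    omega
  refine ⟨Multiset.replicate (Fintype.card G) g, Multiset.le_count_iff_replicate_le.1 hg, ?_, ?_⟩
  · rw [← Multiset.card_pos, Multiset.card_replicate]
    exact Fintype.card_pos
  · simp

theorem card_lt_Davenport {G : Type*} [AddCommGroup G] [Finite G] {S : Multiset G}
    (h : ∀ U ≤ S, U ≠ 0 → U.sum ≠ 0) : Multiset.card S < Davenport G := by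
  by_contra! hle
  obtain ⟨T, hT, hT0, hs⟩ := (Davenport_spec G).2 S hle
  exact h T hT hT0 hs

theorem exists_zeroSumFree_card (G : Type*) [AddCommGroup G] [Finite G] :
    ∃ S : Multiset G, Multiset.card S + 1 = Davenport G ∧ ∀ U ≤ S, U ≠ 0 → U.sum ≠ 0 := by
  have hpos := (Davenport_spec G).1
  by_cases h1 : Davenport G = 1
  · exact ⟨0, by simp [h1], fun U hU hU0 => absurd (Multiset.le_zero.1 hU) hU0⟩
  · have hnot : Davenport G - 1 ∉ {ℓ : ℕ | 0 < ℓ ∧ ∀ S : Multiset G, ℓ ≤ Multiset.card S →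
        ∃ T : Multiset G, T ≤ S ∧ T ≠ 0 ∧ T.sum = 0} :=
      Nat.notMem_of_lt_sInf (Nat.sub_lt hpos one_pos)
    simp only [Set.mem_ofPred_eq, not_and, not_forall] at hnot
    obtain ⟨S, hS, hfree⟩ := hnot (by omega)
    have hS' : ∀ U ≤ S, U ≠ 0 → U.sum ≠ 0 := fun U hU hU0 hs => hfree ⟨U, hU, hU0, hs⟩
    have := card_lt_Davenport hS'
    exact ⟨S, by omega, hS'⟩

theorem stmt12 {G : Type*} [AddCommGroup G] [Fintype G] [DecidableEq G]
    (hyp : ∃ t : ℕ, ∀ S : Multiset G, (0 : G) ∉ S →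
      Davenport G - 1 ≤ Multiset.card S →
      NSub S 0 = 2 ^ (Multiset.card S + 1 - Davenport G) →
      Multiset.card S ≤ t) :
    ∀ H : AddSubgroup G, Nonempty (H ≃+ ZMod 2) →
      Davenport (G ⧸ H) + 2 ≤ Davenport G := by
  rintro H ⟨e⟩
  obtain ⟨t, ht⟩ := hyp
  obtain ⟨h, hH, hne, hh⟩ : ∃ h ∈ H, h ≠ 0 ∧ h + h = 0 := by
    refine ⟨e.symm 1, (e.symm 1).2, ?_, ?_⟩
    · simp
    · rw [← AddSubgroup.coe_add, ← map_add, show (1 : ZMod 2) + 1 = 0 from rfl, map_zero,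
        AddSubgroup.coe_zero]
  obtain ⟨R, hcard, hfree⟩ := exists_zeroSumFree_card (G ⧸ H)
  obtain ⟨S, rfl⟩ := Multiset.map_surjective_of_surjective (QuotientAddGroup.mk'_surjective H) R
  rw [Multiset.card_map] at hcard
  have hS : ∀ U ≤ S, U ≠ 0 → U.sum ∉ H := by
    intro U hU hU0 hs
    refine hfree (U.map (QuotientAddGroup.mk' H)) (Multiset.map_le_map hU) (by simpa using hU0) ?_
    rw [← map_multiset_sum]
    exact (QuotientAddGroup.eq_zero_iff _).2 hs
  have hS0 : ∀ U ≤ S, U ≠ 0 → U.sum ≠ 0 := fun U hU hU0 hs => hS U hU hU0 (hs ▸ H.zero_mem)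
  have hSh : ∀ U ≤ S, U.sum ≠ h := by
    intro U hU hs
    by_cases hU0 : U = 0
    · exact hne (by simpa [hU0] using hs.symm)
    · exact hS U hU hU0 (hs ▸ hH)
  have hcount n := (NSub_add_replicate hh (NSub_zero_eq_one hS0) (NSub_eq_zero hSh) n).1
  have hlower : Multiset.card (h ::ₘ S) < Davenport G := by
    refine card_lt_Davenport fun U hU hU0 hs => ?_
    by_cases hmem : h ∈ U
    · obtain ⟨V, rfl⟩ := Multiset.exists_cons_of_mem hmem
      rw [Multiset.sum_cons] at hs
      refine hSh V ((Multiset.cons_le_cons_iff h).1 hU) ?_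
      rw [← neg_eq_of_add_eq_zero_right hs, neg_eq_of_add_eq_zero_right hh]
    · exact hS0 U ((Multiset.le_cons_of_notMem hmem).1 hU) hU0 hs
  rw [Multiset.card_cons] at hlower
  by_contra hlt
  have hbound := ht (S + Multiset.replicate (t + 1) h) (by
    rw [Multiset.mem_add, not_or]
    refine ⟨fun hmem => ?_, fun hmem => hne (Multiset.eq_of_mem_replicate hmem).symm⟩
    exact hS0 {0} (Multiset.singleton_le.2 hmem) (by simp) (by simp))
    (by rw [Multiset.card_add, Multiset.card_replicate]; omega)
    (by
      rw [hcount, Multiset.card_add, Multiset.card_replicate]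
      congr 1
      omega)
  rw [Multiset.card_add, Multiset.card_replicate] at hbound
  omega
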